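/- arXiv:1912.06849 — 6 statements merged into one kernel-verified Lean document; each statement's English description precedes it below -/
import Mathlib

section
/- Let N ≥ 1 and let U ⊆ ℂ^N × ℂ^N be an open set with coordinates (x₁,…,x_N, λ₁,…,λ_N). For each i ∈ {1,…,N} let R_i : ℂ × ℂ × ℂ^N → ℂ be continuously differentiable, and let H = (H₁,…,H_N) : U → ℂ^N be differentiable and satisfy the separation relations R_i(x_i, λ_i, H(x,λ)) = 0 for every (x,λ) ∈ U and every i. Fix a point u ∈ U at which the N×N matrix M with entries M_{ij} = (∂R_i/∂H_j)(x_i, λ_i, H(u)) is invertible. Then for all indices a, b, i one has (∂H_a/∂λ_i)(∂H_b/∂x_i) − (∂H_a/∂x_i)(∂H_b/∂λ_i) = 0 at u; consequently, for every weight vector w ∈ ℂ^N, Σ_{i=1}^{N} w_i [(∂H_a/∂λ_i)(∂H_b/∂x_i) − (∂H_a/∂x_i)(∂H_b/∂λ_i)] = 0 at u, i.e. the Hamiltonians H₁,…,H_N pairwise Poisson-commute with respect to the Poisson bracket determined by {λ_i, x_j} = δ_{ij} w_i. -/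
/-- A linear functional on `ℂ × ℂ × ℂ^N`, expanded along the coordinate vectors of `ℂ^N`. -/
theorem apply_eq_add_sum_single {N : ℕ} (L : (ℂ × ℂ × (Fin N → ℂ)) →L[ℂ] ℂ)
    (x y : ℂ) (h : Fin N → ℂ) :
    L (x, y, h) = L (x, y, 0) + ∑ j, L (0, 0, Pi.single j 1) * h j := by
  have hsplit : ((x, y, h) : ℂ × ℂ × (Fin N → ℂ)) =
      (x, y, 0) + ∑ j, h j • ((0, 0, Pi.single j 1) : ℂ × ℂ × (Fin N → ℂ)) := by
    refine Prod.ext ?_ (Prod.ext ?_ ?_)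
    · simp [Prod.fst_sum]
    · simp [Prod.fst_sum, Prod.snd_sum]
    · ext k
      simp [Prod.snd_sum, Finset.sum_apply, Pi.single_apply]
  rw [hsplit, map_add, map_sum]
  simp only [map_smul, smul_eq_mul, mul_comm]

/-- If an invertible matrix sends a vector to a multiple of a basis vector, then the vector is
the same multiple of a column of the inverse matrix. -/
theorem eq_inv_mul_of_mulVec_eq_single {n K : Type*} [Fintype n] [DecidableEq n] [CommRing K]
    {M : Matrix n n K} (hM : IsUnit M.det) {p : n → K} {i : n} {c : K}
    (h : M.mulVec p = Pi.single i c) (a : n) : p a = M⁻¹ a i * c := by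
  have hp : p = M⁻¹.mulVec (Pi.single i c) := by
    rw [← h, Matrix.mulVec_mulVec, Matrix.nonsing_inv_mul _ hM, Matrix.one_mulVec]
  rw [hp]
  simp [Matrix.mulVec_single]

/-- Differentiating an identity `r (x_k, λ_k, H (x, λ)) = 0` in a direction `v`. -/
theorem fderiv_separation_relation {N : ℕ} {U : Set ((Fin N → ℂ) × (Fin N → ℂ))} (hU : IsOpen U)
    {r : (ℂ × ℂ × (Fin N → ℂ)) → ℂ} {H : ((Fin N → ℂ) × (Fin N → ℂ)) → (Fin N → ℂ)} {k : Fin N}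
    (hsep : ∀ u ∈ U, r (u.1 k, u.2 k, H u) = 0)
    {u : (Fin N → ℂ) × (Fin N → ℂ)} (hu : u ∈ U)
    (hr : DifferentiableAt ℂ r (u.1 k, u.2 k, H u)) (hH : DifferentiableAt ℂ H u)
    (v : (Fin N → ℂ) × (Fin N → ℂ)) :
    fderiv ℂ r (u.1 k, u.2 k, H u) (v.1 k, v.2 k, fderiv ℂ H u v) = 0 := by
  have h1 : HasFDerivAt (fun z : (Fin N → ℂ) × (Fin N → ℂ) => z.1 k)
      ((ContinuousLinearMap.proj (R := ℂ) (φ := fun _ : Fin N => ℂ) k).comp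
        (ContinuousLinearMap.fst ℂ (Fin N → ℂ) (Fin N → ℂ))) u :=
    ((ContinuousLinearMap.proj (R := ℂ) (φ := fun _ : Fin N => ℂ) k).comp
      (ContinuousLinearMap.fst ℂ (Fin N → ℂ) (Fin N → ℂ))).hasFDerivAt
  have h2 : HasFDerivAt (fun z : (Fin N → ℂ) × (Fin N → ℂ) => z.2 k)
      ((ContinuousLinearMap.proj (R := ℂ) (φ := fun _ : Fin N => ℂ) k).comp
        (ContinuousLinearMap.snd ℂ (Fin N → ℂ) (Fin N → ℂ))) u :=
    ((ContinuousLinearMap.proj (R := ℂ) (φ := fun _ : Fin N => ℂ) k).comp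
      (ContinuousLinearMap.snd ℂ (Fin N → ℂ) (Fin N → ℂ))).hasFDerivAt
  have hcomp := HasFDerivAt.comp u hr.hasFDerivAt (h1.prodMk (h2.prodMk hH.hasFDerivAt))
  have hzero : HasFDerivAt (r ∘ fun z : (Fin N → ℂ) × (Fin N → ℂ) => (z.1 k, z.2 k, H z))
      (0 : ((Fin N → ℂ) × (Fin N → ℂ)) →L[ℂ] ℂ) u :=
    (hasFDerivAt_const (0 : ℂ) u).congr_of_eventuallyEq
      (Filter.eventuallyEq_of_mem (hU.mem_nhds hu) hsep)
  exact DFunLike.congr_fun (hcomp.unique hzero) v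

/-- Hamiltonians defined implicitly by separation relations
`R_i(x_i, λ_i, H(x,λ)) = 0` Poisson-commute with respect to the bracket
`{λ_i, x_j} = δ_{ij} w_i`, provided the matrix `(∂R_i/∂H_j)` is invertible
at the point considered. -/
theorem hamiltonians_poisson_commute
    (N : ℕ) (hN : 1 ≤ N)
    (U : Set ((Fin N → ℂ) × (Fin N → ℂ))) (hU : IsOpen U)
    (R : Fin N → (ℂ × ℂ × (Fin N → ℂ)) → ℂ)
    (hR : ∀ i, ContDiff ℂ 1 (R i))
    (H : ((Fin N → ℂ) × (Fin N → ℂ)) → (Fin N → ℂ))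
    (hH : DifferentiableOn ℂ H U)
    (hsep : ∀ u ∈ U, ∀ i : Fin N, R i (u.1 i, u.2 i, H u) = 0)
    (u : (Fin N → ℂ) × (Fin N → ℂ)) (hu : u ∈ U)
    (hM : IsUnit (Matrix.det (Matrix.of fun i j : Fin N =>
      fderiv ℂ (R i) (u.1 i, u.2 i, H u) (0, 0, Pi.single j 1)))) :
    (∀ a b i : Fin N,
      fderiv ℂ H u (0, Pi.single i 1) a * fderiv ℂ H u (Pi.single i 1, 0) b -
        fderiv ℂ H u (Pi.single i 1, 0) a * fderiv ℂ H u (0, Pi.single i 1) b = 0) ∧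
    (∀ (w : Fin N → ℂ) (a b : Fin N),
      ∑ i : Fin N, w i *
        (fderiv ℂ H u (0, Pi.single i 1) a * fderiv ℂ H u (Pi.single i 1, 0) b -
          fderiv ℂ H u (Pi.single i 1, 0) a * fderiv ℂ H u (0, Pi.single i 1) b) = 0) := by
  have hHu : DifferentiableAt ℂ H u := hH.differentiableAt (hU.mem_nhds hu)
  have hrel : ∀ (v : (Fin N → ℂ) × (Fin N → ℂ)) (k : Fin N),
      (Matrix.of fun i j : Fin N =>
        fderiv ℂ (R i) (u.1 i, u.2 i, H u) (0, 0, Pi.single j 1)).mulVec (fderiv ℂ H u v) k =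
      -fderiv ℂ (R k) (u.1 k, u.2 k, H u) (v.1 k, v.2 k, 0) := by
    intro v k
    have h := fderiv_separation_relation hU (fun z hz => hsep z hz k) hu
      ((hR k).differentiable one_ne_zero _) hHu v
    rw [apply_eq_add_sum_single] at h
    exact eq_neg_of_add_eq_zero_right h
  have hx : ∀ i a : Fin N, fderiv ℂ H u (Pi.single i 1, 0) a = _ := fun i =>
    eq_inv_mul_of_mulVec_eq_single hM (i := i)
      (c := -fderiv ℂ (R i) (u.1 i, u.2 i, H u) (1, 0, 0)) (by
        ext k
        rw [hrel]
        rcases eq_or_ne k i with rfl | hk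
        · simp
        · simp [hk]
          exact map_zero (fderiv ℂ (R k) (u.1 k, u.2 k, H u)))
  have hl : ∀ i a : Fin N, fderiv ℂ H u (0, Pi.single i 1) a = _ := fun i =>
    eq_inv_mul_of_mulVec_eq_single hM (i := i)
      (c := -fderiv ℂ (R i) (u.1 i, u.2 i, H u) (0, 1, 0)) (by
        ext k
        rw [hrel]
        rcases eq_or_ne k i with rfl | hk
        · simp
        · simp [hk]
          exact map_zero (fderiv ℂ (R k) (u.1 k, u.2 k, H u)))
  have hcomm : ∀ a b i : Fin N,
      fderiv ℂ H u (0, Pi.single i 1) a * fderiv ℂ H u (Pi.single i 1, 0) b -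
        fderiv ℂ H u (Pi.single i 1, 0) a * fderiv ℂ H u (0, Pi.single i 1) b = 0 := by
    intro a b i
    rw [hx, hx, hl, hl]
    ring
  exact ⟨hcomm, fun w a b => Finset.sum_eq_zero fun i _ => by rw [hcomm, mul_zero]⟩
end

section
/- Let U = {(x,λ) ∈ ℂ³ × ℂ³ : x₁, x₂, x₃ pairwise distinct} and define H₀, H₁, H₂ : U → ℂ as the unique solution of the linear system λ_i² + H₀ + H₁ x_i + H₂ x_i² = 0 (i = 1,2,3), i.e. (H₀,H₁,H₂)ᵀ = −V(x)⁻¹ (λ₁², λ₂², λ₃²)ᵀ where V(x) is the Vandermonde matrix with rows (1, x_i, x_i²). Then for all a, b ∈ {0,1,2}, every point of U, and every weight vector w ∈ ℂ³, Σ_{i=1}^{3} w_i [(∂H_a/∂λ_i)(∂H_b/∂x_i) − (∂H_a/∂x_i)(∂H_b/∂λ_i)] = 0. In particular, taking w_i = y_i with y_i² = P(x_i), the three Hitchin Hamiltonians of the SL(2) system on a genus-2 hyperelliptic curve Poisson-commute in the separating variables with respect to the bracket {λ_i, x_j} = δ_{ij} y_i. -/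
open Filter Topology in
/-- Differentiating the separation relations `λ_i² + ∑ k, H_k x_i ^ k = 0` in the direction `e`. -/
theorem vandermonde_mulVec_fderiv {n : ℕ}
    (H : ((Fin n → ℂ) × (Fin n → ℂ)) → (Fin n → ℂ))
    (hH : ∀ p : (Fin n → ℂ) × (Fin n → ℂ),
      H p = -((Matrix.vandermonde p.1)⁻¹.mulVec (fun i => p.2 i ^ 2)))
    (u : (Fin n → ℂ) × (Fin n → ℂ)) (hu : Function.Injective u.1)
    (hd : DifferentiableAt ℂ H u) (e : (Fin n → ℂ) × (Fin n → ℂ)) :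
    (Matrix.vandermonde u.1).mulVec (fderiv ℂ H u e) = fun i =>
      -(2 * u.2 i * e.2 i + (∑ k : Fin n, (k : ℕ) * u.1 i ^ ((k : ℕ) - 1) * H u k) * e.1 i) := by
  have hline : HasDerivAt (fun t : ℂ => u + t • e) e 0 := by
    simpa using ((hasDerivAt_id (0 : ℂ)).smul_const e).const_add u
  have hd0 : HasFDerivAt H (fderiv ℂ H u) (u + (0 : ℂ) • e) := by
    simpa using hd.hasFDerivAt
  have hcomp : HasDerivAt (fun t : ℂ => H (u + t • e)) (fderiv ℂ H u e) 0 :=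
    hd0.comp_hasDerivAt (0 : ℂ) hline
  have hcont : Continuous (fun t : ℂ => (Matrix.vandermonde (u + t • e).1).det) := by
    simp only [Matrix.det_vandermonde]
    fun_prop
  have hdet : ∀ᶠ t : ℂ in 𝓝 0, (Matrix.vandermonde (u + t • e).1).det ≠ 0 := by
    refine hcont.continuousAt.eventually_ne ?_
    simpa using Matrix.det_vandermonde_ne_zero_iff.mpr hu
  funext i
  have hzero : (fun t : ℂ => (u.2 i + t * e.2 i) ^ 2
      + ∑ k : Fin n, (u.1 i + t * e.1 i) ^ (k : ℕ) * H (u + t • e) k) =ᶠ[𝓝 0] fun _ => 0 := by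
    filter_upwards [hdet] with t ht
    have h := congrFun (congrArg (Matrix.vandermonde (u + t • e).1).mulVec (hH (u + t • e))) i
    rw [Matrix.mulVec_neg, Matrix.mulVec_mulVec,
      Matrix.mul_nonsing_inv _ (isUnit_iff_ne_zero.mpr ht), Matrix.one_mulVec] at h
    simp only [Matrix.mulVec, dotProduct, Matrix.vandermonde_apply, Pi.neg_apply, Prod.fst_add,
      Prod.snd_add, Prod.smul_fst, Prod.smul_snd, Pi.add_apply, Pi.smul_apply, smul_eq_mul] at h
    rw [h]
    ring
  have hcoord (a b : ℂ) : HasDerivAt (fun t : ℂ => a + t * b) b 0 := by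
    simpa using ((hasDerivAt_id (0 : ℂ)).mul_const b).const_add a
  have hG := ((hcoord (u.2 i) (e.2 i)).fun_pow 2).fun_add (HasDerivAt.fun_sum
    (u := Finset.univ) fun (k : Fin n) _ =>
      ((hcoord (u.1 i) (e.1 i)).fun_pow (k : ℕ)).fun_mul (hasDerivAt_pi.mp hcomp k))
  have key := hG.unique ((hasDerivAt_const (0 : ℂ) (0 : ℂ)).congr_of_eventuallyEq hzero)
  simp only [zero_mul, add_zero, zero_smul, Finset.sum_add_distrib] at key
  simp only [Matrix.mulVec, dotProduct, Matrix.vandermonde_apply, Finset.sum_mul]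
  have hs : ∑ k : Fin n, (k : ℕ) * u.1 i ^ ((k : ℕ) - 1) * H u k * e.1 i
      = ∑ k : Fin n, (k : ℕ) * u.1 i ^ ((k : ℕ) - 1) * e.1 i * H u k :=
    Finset.sum_congr rfl fun k _ => by ring
  rw [hs]
  norm_num at key
  linear_combination key

/-- The three Hitchin Hamiltonians of the SL(2) system on a genus-2
hyperelliptic curve, obtained by solving the separation relations
`λ_i² + H₀ + H₁ x_i + H₂ x_i² = 0` via the Vandermonde matrix, Poisson-commute
in the separating variables with respect to any bracket `{λ_i, x_j} = δ_{ij} w_i`. -/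
theorem sl2_hamiltonians_poisson_commute
    (U : Set ((Fin 3 → ℂ) × (Fin 3 → ℂ)))
    (hU : U = {p : (Fin 3 → ℂ) × (Fin 3 → ℂ) | Function.Injective p.1})
    (H : ((Fin 3 → ℂ) × (Fin 3 → ℂ)) → (Fin 3 → ℂ))
    (hH : ∀ p : (Fin 3 → ℂ) × (Fin 3 → ℂ),
      H p = -((Matrix.vandermonde p.1)⁻¹.mulVec (fun i => p.2 i ^ 2))) :
    ∀ u ∈ U, ∀ (a b : Fin 3) (w : Fin 3 → ℂ),
      ∑ i : Fin 3, w i *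
        (fderiv ℂ H u (0, Pi.single i 1) a * fderiv ℂ H u (Pi.single i 1, 0) b -
          fderiv ℂ H u (Pi.single i 1, 0) a * fderiv ℂ H u (0, Pi.single i 1) b) = 0 := by
  intro u hu a b w
  rw [hU] at hu
  by_cases hd : DifferentiableAt ℂ H u
  swap
  · simp [fderiv_zero_of_not_differentiableAt hd]
  refine Finset.sum_eq_zero fun j _ => ?_
  have hdet : IsUnit (Matrix.vandermonde u.1).det :=
    isUnit_iff_ne_zero.mpr (Matrix.det_vandermonde_ne_zero_iff.mpr hu)
  have hpar (v : Fin 3 → ℂ) (c : Fin 3 → ℂ)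
      (h : (Matrix.vandermonde u.1).mulVec v = fun i => c i * (Pi.single j 1 : Fin 3 → ℂ) i) :
      v = c j • (Matrix.vandermonde u.1)⁻¹.mulVec (Pi.single j 1) := by
    have hc : (fun i => c i * (Pi.single j 1 : Fin 3 → ℂ) i) = c j • Pi.single j 1 := by
      funext i
      by_cases hij : i = j
      · subst hij
        simp
      · simp [hij]
    rw [← Matrix.mulVec_smul, ← hc, ← h, Matrix.mulVec_mulVec,
      Matrix.nonsing_inv_mul _ hdet, Matrix.one_mulVec]
  have hlam := hpar _ (fun i => -(2 * u.2 i))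
    ((vandermonde_mulVec_fderiv H hH u hu hd (0, Pi.single j 1)).trans (by
      funext i
      simp))
  have hx := hpar _ (fun i => -∑ k : Fin 3, (k : ℕ) * u.1 i ^ ((k : ℕ) - 1) * H u k)
    ((vandermonde_mulVec_fderiv H hH u hu hd (Pi.single j 1, 0)).trans (by
      funext i
      simp only [Pi.zero_apply, mul_zero, zero_add, neg_mul]))
  rw [hlam, hx]
  simp only [Pi.smul_apply, smul_eq_mul]
  ring
end

section
/- Let P, p, q ∈ ℂ[x] satisfy: P is squarefree of degree 5; q is squarefree of degree 2; q and P are coprime; 2q − p and 2q + p are both squarefree; and (2q−p)(2q+p) is coprime to P. Put F(x,λ) = λ⁴ + λ²·p(x) + q(x)², and let C = {(x,y,λ) ∈ ℂ³ : y² = P(x), F(x,λ) = 0}. Then the set of singular points of C — the points of C at which the 2×3 Jacobian matrix [[−P'(x), 2y, 0], [λ²p'(x) + 2q(x)q'(x), 0, 4λ³ + 2λp(x)]] has rank ≤ 1 — is exactly {(x,y,0) : q(x) = 0, y² = P(x)}, and this set has exactly 4 elements. -/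
open Polynomial in
theorem IsCoprime.not_eval_eq_zero_and {f g : ℂ[X]} (h : IsCoprime f g) {x : ℂ}
    (hf : f.eval x = 0) (hg : g.eval x = 0) : False := by
  obtain ⟨a, b, hab⟩ := h
  have := congrArg (Polynomial.eval x) hab
  simp [hf, hg] at this

open Polynomial in
theorem Squarefree.not_eval_derivative_eq_zero {f : ℂ[X]} (h : Squarefree f) {x : ℂ}
    (hf : f.eval x = 0) (hf' : f.derivative.eval x = 0) : False :=
  IsCoprime.not_eval_eq_zero_and (PerfectField.separable_iff_squarefree.mpr h) hf hf'

theorem Matrix.exists_row_relation_of_rank_le_one {A : Matrix (Fin 2) (Fin 3) ℂ}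
    (h : A.rank ≤ 1) : ∃ s t : ℂ, (∀ j, s * A 0 j + t * A 1 j = 0) ∧ (s ≠ 0 ∨ t ≠ 0) := by
  have hA : ¬ LinearIndependent ℂ A.row := by
    intro hli
    have := hli.rank_matrix
    simp at this
    omega
  have hA' : ¬ LinearIndependent ℂ ![A.row 0, A.row 1] := by
    convert hA using 2
    ext i : 1
    fin_cases i <;> rfl
  rw [LinearIndependent.pair_iff] at hA'
  push Not at hA'
  obtain ⟨s, t, hst, hne⟩ := hA'
  refine ⟨s, t, fun j => by simpa using congrFun hst j, ?_⟩
  by_cases hs : s = 0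
  · exact Or.inr (hne hs)
  · exact Or.inl hs

theorem Matrix.rank_le_one_of_second_row_eq_zero (a b c : ℂ) :
    Matrix.rank !![a, b, c; 0, 0, 0] ≤ 1 := by
  have : !![a, b, c; 0, 0, 0] = Matrix.vecMulVec ![1, 0] ![a, b, c] := by
    ext i j
    fin_cases i <;> fin_cases j <;> simp [Matrix.vecMulVec]
  rw [this]
  exact Matrix.rank_vecMulVec_le _ _

open Polynomial in
/-- A squarefree complex quadratic has exactly two roots. -/
theorem Squarefree.exists_two_roots {q : ℂ[X]} (hq : Squarefree q) (hdeg : q.natDegree = 2) :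
    ∃ a b : ℂ, a ≠ b ∧ ∀ x, q.eval x = 0 ↔ x = a ∨ x = b := by
  have hcard : q.roots.toFinset.card = 2 := by
    rw [Multiset.toFinset_card_of_nodup
      (nodup_roots (PerfectField.separable_iff_squarefree.mpr hq)),
      IsAlgClosed.card_roots_eq_natDegree, hdeg]
  obtain ⟨a, b, hab, h⟩ := Finset.card_eq_two.mp hcard
  refine ⟨a, b, hab, fun x => ?_⟩
  have hx : x ∈ q.roots.toFinset ↔ x ∈ ({a, b} : Finset ℂ) := by rw [h]
  simpa [hq.ne_zero] using hx

open Polynomial in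
theorem so4_eq_zero_of_singular {P p q : ℂ[X]} (hP : Squarefree P)
    (h1 : Squarefree (2 * q - p)) (h2 : Squarefree (2 * q + p))
    (h3 : IsCoprime ((2 * q - p) * (2 * q + p)) P) {x y l s t : ℂ}
    (hy : y ^ 2 = P.eval x) (hF : l ^ 4 + l ^ 2 * p.eval x + (q.eval x) ^ 2 = 0)
    (hst : s ≠ 0 ∨ t ≠ 0)
    (e0 : s * -(P.derivative.eval x) +
      t * (l ^ 2 * p.derivative.eval x + 2 * q.eval x * q.derivative.eval x) = 0)
    (e1 : s * (2 * y) = 0) (e2 : t * (4 * l ^ 3 + 2 * l * p.eval x) = 0) : l = 0 := by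
  by_contra hl
  have ht : t ≠ 0 := by
    rintro rfl
    have hs : s ≠ 0 := by simpa using hst
    have hy0 : y = 0 := by simpa [hs] using e1
    refine hP.not_eval_derivative_eq_zero (x := x) ?_ ?_
    · rw [← hy, hy0]; simp
    · simpa [hs] using e0
  have hp : p.eval x = -2 * l ^ 2 := by
    have h := (mul_eq_zero.mp e2).resolve_left ht
    have h' : (2 * l) * (p.eval x + 2 * l ^ 2) = 0 := by linear_combination h
    have := (mul_eq_zero.mp h').resolve_left (by simpa using hl)
    linear_combination this
  have hq : (q.eval x - l ^ 2) * (q.eval x + l ^ 2) = 0 := by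
    rw [hp] at hF
    linear_combination hF
  by_cases hs : s = 0
  · have e0' : l ^ 2 * p.derivative.eval x + 2 * q.eval x * q.derivative.eval x = 0 := by
      simpa [hs, ht] using e0
    have hl2 : l ^ 2 ≠ 0 := pow_ne_zero 2 hl
    rcases mul_eq_zero.mp hq with h | h
    · refine h2.not_eval_derivative_eq_zero (x := x) ?_ ?_
      · simp only [eval_add, eval_mul, eval_ofNat]
        linear_combination 2 * h + hp
      · apply mul_left_cancel₀ hl2
        simp only [derivative_add, derivative_mul, derivative_ofNat, eval_add,
          eval_mul, eval_ofNat, zero_mul, zero_add, mul_zero]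
        linear_combination e0' - 2 * q.derivative.eval x * h
    · refine h1.not_eval_derivative_eq_zero (x := x) ?_ ?_
      · simp only [eval_sub, eval_mul, eval_ofNat]
        linear_combination 2 * h - hp
      · apply mul_left_cancel₀ hl2
        simp only [derivative_sub, derivative_mul, derivative_ofNat,
          eval_sub, eval_mul, eval_ofNat, zero_mul, zero_add, mul_zero]
        linear_combination -e0' + 2 * q.derivative.eval x * h
  · have hy0 : y = 0 := by simpa [hs] using e1
    refine h3.not_eval_eq_zero_and (x := x) ?_ ?_
    · simp only [eval_mul, eval_sub, eval_add, eval_ofNat, hp]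
      linear_combination 4 * hq
    · rw [← hy, hy0]; simp


/-- For the SO(4) spectral curve `y² = P(x)`, `λ⁴ + λ²p(x) + q(x)² = 0`
in generic position, the singular locus is exactly `{(x,y,0) : q(x) = 0, y² = P(x)}`,
and it has exactly 4 points. A point `(x,y,λ)` of the curve is singular iff the
2×3 Jacobian matrix of the defining equations has rank ≤ 1. -/
theorem so4_singular_locus
    (P p q : Polynomial ℂ) (hP : Squarefree P) (hPdeg : P.natDegree = 5)
    (hq : Squarefree q) (hqdeg : q.natDegree = 2) (hqP : IsCoprime q P)
    (h1 : Squarefree (2 * q - p)) (h2 : Squarefree (2 * q + p))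
    (h3 : IsCoprime ((2 * q - p) * (2 * q + p)) P)
    (Sing : Set (ℂ × ℂ × ℂ))
    (hSing : Sing = {v : ℂ × ℂ × ℂ |
      (v.2.1 ^ 2 = P.eval v.1 ∧
        v.2.2 ^ 4 + v.2.2 ^ 2 * p.eval v.1 + (q.eval v.1) ^ 2 = 0) ∧
      Matrix.rank !![-(P.derivative.eval v.1), 2 * v.2.1, 0;
        v.2.2 ^ 2 * p.derivative.eval v.1 + 2 * q.eval v.1 * q.derivative.eval v.1, 0,
        4 * v.2.2 ^ 3 + 2 * v.2.2 * p.eval v.1] ≤ 1}) :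
    Sing = {v : ℂ × ℂ × ℂ | q.eval v.1 = 0 ∧ v.2.1 ^ 2 = P.eval v.1 ∧ v.2.2 = 0} ∧
    Sing.Finite ∧ Sing.ncard = 4 := by
  have hset : Sing =
      {v : ℂ × ℂ × ℂ | q.eval v.1 = 0 ∧ v.2.1 ^ 2 = P.eval v.1 ∧ v.2.2 = 0} := by
    rw [hSing]
    ext ⟨x, y, l⟩
    simp only [Set.mem_ofPred_eq]
    constructor
    · rintro ⟨⟨hy, hF⟩, hr⟩
      obtain ⟨s, t, h, hst⟩ := Matrix.exists_row_relation_of_rank_le_one hr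
      have hl : l = 0 := so4_eq_zero_of_singular hP h1 h2 h3 hy hF hst
        (by simpa using h 0) (by simpa using h 1) (by simpa using h 2)
      refine ⟨?_, hy, hl⟩
      simpa [hl] using hF
    · rintro ⟨hqx, hy, rfl⟩
      refine ⟨⟨hy, by simp [hqx]⟩, ?_⟩
      simpa [hqx] using Matrix.rank_le_one_of_second_row_eq_zero
        (-(P.derivative.eval x)) (2 * y) 0
  obtain ⟨a, b, hab, hroots⟩ := hq.exists_two_roots hqdeg
  obtain ⟨s, hs⟩ := IsAlgClosed.exists_pow_nat_eq (P.eval a) two_pos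
  obtain ⟨t, ht⟩ := IsAlgClosed.exists_pow_nat_eq (P.eval b) two_pos
  have hs0 : s ≠ 0 := by
    rintro rfl
    exact hqP.not_eval_eq_zero_and ((hroots a).mpr (Or.inl rfl)) (by simpa using hs.symm)
  have ht0 : t ≠ 0 := by
    rintro rfl
    exact hqP.not_eval_eq_zero_and ((hroots b).mpr (Or.inr rfl)) (by simpa using ht.symm)
  have hfin : Sing =
      (({(a, s, 0), (a, -s, 0), (b, t, 0), (b, -t, 0)} : Finset (ℂ × ℂ × ℂ)) :
        Set (ℂ × ℂ × ℂ)) := by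
    rw [hset]
    ext ⟨x, y, l⟩
    simp only [Set.mem_ofPred_eq, hroots, Finset.coe_insert, Finset.coe_singleton,
      Set.mem_insert_iff, Set.mem_singleton_iff, Prod.mk.injEq]
    constructor
    · rintro ⟨rfl | rfl, hy, rfl⟩
      · rw [← hs, sq_eq_sq_iff_eq_or_eq_neg] at hy
        tauto
      · rw [← ht, sq_eq_sq_iff_eq_or_eq_neg] at hy
        tauto
    · rintro (⟨rfl, rfl, rfl⟩ | ⟨rfl, rfl, rfl⟩ | ⟨rfl, rfl, rfl⟩ | ⟨rfl, rfl, rfl⟩) <;>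
        simp [hs, ht]
  refine ⟨hset, hfin ▸ Finset.finite_toSet _, ?_⟩
  rw [hfin, Set.ncard_coe_finset]
  have hss : s ≠ -s := fun h => hs0 (self_eq_neg.mp h)
  have htt : t ≠ -t := fun h => ht0 (self_eq_neg.mp h)
  rw [Finset.card_insert_of_notMem, Finset.card_insert_of_notMem,
    Finset.card_insert_of_notMem, Finset.card_singleton] <;>
    simp [hab, hss, htt]
end

section
/- Let P, c, b ∈ ℂ[x] with P squarefree, c² − P·b² squarefree, and c and b coprime. Then there is no point (x,y) ∈ ℂ² satisfying simultaneously y² = P(x), c(x) + y·b(x) = 0, and 2y·(c'(x) + y·b'(x)) + b(x)·P'(x) = 0. -/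
/-- A generic function `c(x) + y·b(x)` on the hyperelliptic curve
`y² = P(x)` has no multiple zeros: there is no point where `c + y·b` and its total
derivative along the curve (cleared of denominators) both vanish, provided `P` and
`c² − P·b²` are squarefree and `c`, `b` are coprime. -/
theorem no_multiple_zeros_on_base_curve
    (P c b : Polynomial ℂ) (hP : Squarefree P)
    (hsf : Squarefree (c ^ 2 - P * b ^ 2)) (hcb : IsCoprime c b) :
    ¬ ∃ x y : ℂ, y ^ 2 = P.eval x ∧ c.eval x + y * b.eval x = 0 ∧
      2 * y * (c.derivative.eval x + y * b.derivative.eval x) +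
        b.eval x * P.derivative.eval x = 0 := by
  rintro ⟨x, y, hy, hf, hdf⟩
  obtain ⟨u, v, huv⟩ := PerfectField.separable_iff_squarefree.mpr hsf
  have hc : c.eval x = -(y * b.eval x) := by linear_combination hf
  have hroot : (c ^ 2 - P * b ^ 2).eval x = 0 := by
    simp only [Polynomial.eval_sub, Polynomial.eval_mul, Polynomial.eval_pow, hc, ← hy]
    ring
  have hderiv : (c ^ 2 - P * b ^ 2).derivative.eval x = 0 := by
    simp only [pow_two, Polynomial.derivative_sub, Polynomial.derivative_mul,
      Polynomial.eval_sub, Polynomial.eval_add, Polynomial.eval_mul, hc, ← hy]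
    linear_combination -b.eval x * hdf
  have h := congrArg (Polynomial.eval x) huv
  rw [Polynomial.eval_add, Polynomial.eval_mul, Polynomial.eval_mul, hroot, hderiv] at h
  simp at h
end

section
/- Let P, r₂, a, b ∈ ℂ[x], and set ã = a − r₂²/4. Assume: P is squarefree; a² − P·b² is squarefree; a and b are coprime; ã² − P·b² is squarefree; and ã and b are coprime. Then the affine spectral curve C = {(x,y,λ) ∈ ℂ³ : y² = P(x), λ⁴ + λ²·r₂(x) + a(x) + y·b(x) = 0} is smooth: at every point of C the 2×3 Jacobian matrix [[−P'(x), 2y, 0], [λ²r₂'(x) + a'(x) + y·b'(x), b(x), 4λ³ + 2λ·r₂(x)]] of the two defining equations has rank 2. -/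
/-- Over a perfect field, a root of a squarefree polynomial is not a root of its derivative. -/
theorem Squarefree.eval_derivative_ne_zero {K : Type*} [Field K] [PerfectField K]
    {F : Polynomial K} (hF : Squarefree F) {x : K} (hx : F.eval x = 0) :
    F.derivative.eval x ≠ 0 := by
  intro hx'
  obtain ⟨u, v, huv⟩ := PerfectField.separable_iff_squarefree.mpr hF
  have h := congrArg (Polynomial.eval x) huv
  simp [hx, hx'] at h

/-- If the norm `A ^ 2 - P * b ^ 2` of `A + y * b` is squarefree, then the curve
`y ^ 2 = P`, `A + y * b = 0` is reduced at each of its points. -/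
theorem jacobian_ne_zero_of_squarefree_norm {K : Type*} [Field K] [PerfectField K]
    {P A b : Polynomial K} (hF : Squarefree (A ^ 2 - P * b ^ 2)) {x y : K}
    (hy : y ^ 2 = P.eval x) (hA : A.eval x + y * b.eval x = 0) :
    2 * y * (A.derivative.eval x + y * b.derivative.eval x)
      + P.derivative.eval x * b.eval x ≠ 0 := by
  intro h
  have hA' : A.eval x = -(y * b.eval x) := eq_neg_of_add_eq_zero_left hA
  refine hF.eval_derivative_ne_zero (x := x) ?_ ?_
  · simp only [Polynomial.eval_sub, Polynomial.eval_mul, Polynomial.eval_pow, hA', ← hy]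
    ring
  · simp only [Polynomial.derivative_sub, Polynomial.derivative_mul, Polynomial.derivative_pow,
      Polynomial.eval_sub, Polynomial.eval_add, Polynomial.eval_mul, Polynomial.eval_pow,
      Polynomial.eval_C, hA', ← hy]
    push_cast
    linear_combination (-b.eval x) * h

/-- A `2 × 3` matrix has rank `2` as soon as its rows are not proportional. -/
theorem Matrix.rank_two_by_three_eq_two {K : Type*} [Field K] {p q r s t u : K}
    (h : ∀ c d : K, c * p + d * s = 0 → c * q + d * t = 0 → c * r + d * u = 0 →
      c = 0 ∧ d = 0) :
    Matrix.rank !![p, q, r; s, t, u] = 2 := by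
  have hli : LinearIndependent K (!![p, q, r; s, t, u] : Matrix (Fin 2) (Fin 3) K).row := by
    refine LinearIndependent.pair_iff.mpr fun c d hcd => h c d ?_ ?_ ?_
    · simpa using congrFun hcd 0
    · simpa using congrFun hcd 1
    · simpa using congrFun hcd 2
  simpa using hli.rank_matrix

/-- In generic position the Sp(4) spectral curve `y² = P(x)`,
`λ⁴ + λ²r₂(x) + a(x) + y·b(x) = 0` is smooth: the 2×3 Jacobian matrix of the
two defining equations has rank 2 at every point of the curve. -/
theorem sp4_spectral_curve_smooth
    (P r₂ a b : Polynomial ℂ)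
    (atil : Polynomial ℂ) (hatil : atil = a - Polynomial.C (4⁻¹ : ℂ) * r₂ ^ 2)
    (hP : Squarefree P)
    (h1 : Squarefree (a ^ 2 - P * b ^ 2)) (h2 : IsCoprime a b)
    (h3 : Squarefree (atil ^ 2 - P * b ^ 2)) (h4 : IsCoprime atil b) :
    ∀ x y l : ℂ, y ^ 2 = P.eval x →
      l ^ 4 + l ^ 2 * r₂.eval x + a.eval x + y * b.eval x = 0 →
      Matrix.rank !![-(P.derivative.eval x), 2 * y, 0;
        l ^ 2 * r₂.derivative.eval x + a.derivative.eval x + y * b.derivative.eval x,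
        b.eval x, 4 * l ^ 3 + 2 * l * r₂.eval x] = 2 := by
  intro x y l hy hl
  apply Matrix.rank_two_by_three_eq_two
  intro c d e₁ e₂ e₃
  have hd : d = 0 := by
    by_contra hd
    have hm : l * (2 * l ^ 2 + r₂.eval x) = 0 := by
      have : d * (l * (2 * l ^ 2 + r₂.eval x)) = 0 := by linear_combination e₃ / 2
      exact (mul_eq_zero.mp this).resolve_left hd
    have hminor : 2 * y * (l ^ 2 * r₂.derivative.eval x + a.derivative.eval x
        + y * b.derivative.eval x) + P.derivative.eval x * b.eval x = 0 := by
      refine (mul_eq_zero.mp ?_).resolve_left hd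
      linear_combination 2 * y * e₁ + P.derivative.eval x * e₂
    rcases mul_eq_zero.mp hm with h0 | h0
    · subst h0
      refine jacobian_ne_zero_of_squarefree_norm h1 hy ?_ ?_
      · linear_combination hl
      · linear_combination hminor
    · have hr : r₂.eval x = -(2 * l ^ 2) := by linear_combination h0
      rw [hr] at hl
      refine jacobian_ne_zero_of_squarefree_norm h3 hy ?_ ?_
      · simp only [hatil, Polynomial.eval_sub, Polynomial.eval_mul, Polynomial.eval_pow,
          Polynomial.eval_C, hr]
        linear_combination hl
      · simp only [hatil, Polynomial.derivative_sub, Polynomial.derivative_C_mul,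
          Polynomial.derivative_pow, Polynomial.eval_sub, Polynomial.eval_mul,
          Polynomial.eval_pow, Polynomial.eval_C, hr]
        push_cast
        linear_combination hminor
  refine ⟨?_, hd⟩
  by_contra hc
  simp only [hd, zero_mul, add_zero, mul_eq_zero, hc, false_or, neg_eq_zero,
    OfNat.ofNat_ne_zero] at e₁ e₂
  exact hP.eval_derivative_ne_zero (by simp [← hy, e₂]) e₁
end

section
/- Let P, r₂, a, b ∈ ℂ[x] with deg P = 5, deg b ≤ 1, and set ã = a − r₂²/4. Assume: deg ã = 4; ã² − P·b² is squarefree; ã and b are coprime; and r₂ is coprime to ã² − P·b². Then the set {(x,y,λ) ∈ ℂ³ : y² = P(x), 2λ² + r₂(x) = 0, a(x) + y·b(x) = r₂(x)²/4} is finite with exactly 16 elements. -/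
/-- A squarefree polynomial over an algebraically closed field of characteristic zero has as many
distinct roots as its degree. -/
theorem Squarefree.card_toFinset_roots {K : Type*} [Field K] [IsAlgClosed K] [CharZero K]
    [DecidableEq K] {p : Polynomial K} (hp : Squarefree p) :
    p.roots.toFinset.card = p.natDegree := by
  rw [Multiset.toFinset_card_of_nodup
    (Polynomial.nodup_roots (PerfectField.separable_iff_squarefree.mpr hp))]
  exact (IsAlgClosed.splits p).natDegree_eq_card_roots.symm

theorem Polynomial.natDegree_sq_sub_mul_sq {R : Type*} [CommRing R] [NoZeroDivisors R]
    (p q r : Polynomial R) (h : q.natDegree + 2 * r.natDegree < 2 * p.natDegree) :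
    (p ^ 2 - q * r ^ 2).natDegree = 2 * p.natDegree := by
  have hlt : (q * r ^ 2).natDegree < (p ^ 2).natDegree := by
    rw [Polynomial.natDegree_pow]
    refine lt_of_le_of_lt (Polynomial.natDegree_mul_le.trans ?_) h
    gcongr
    exact Polynomial.natDegree_pow_le
  rw [Polynomial.natDegree_sub_eq_left_of_natDegree_lt hlt, Polynomial.natDegree_pow]

theorem IsCoprime.eval_ne_zero {R : Type*} [CommRing R] [Nontrivial R] {p q : Polynomial R}
    (h : IsCoprime p q) {x : R} (hq : q.eval x = 0) : p.eval x ≠ 0 := by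
  intro hp
  obtain ⟨u, v, huv⟩ := h
  simpa [hp, hq] using congrArg (Polynomial.eval x) huv


/-- For the Sp(4) system on a genus-2 base, the branch locus with
`λ ≠ 0`, given by `y² = P(x)`, `2λ² + r₂(x) = 0`, `a(x) + y·b(x) = r₂(x)²/4`,
consists of exactly 16 points. -/
theorem sp4_branch_points_lambda_nonzero
    (P r₂ a b : Polynomial ℂ) (hPdeg : P.natDegree = 5) (hbdeg : b.natDegree ≤ 1)
    (atil : Polynomial ℂ) (hatil : atil = a - Polynomial.C (4⁻¹ : ℂ) * r₂ ^ 2)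
    (hatdeg : atil.natDegree = 4)
    (hsf : Squarefree (atil ^ 2 - P * b ^ 2)) (hcop : IsCoprime atil b)
    (hr : IsCoprime r₂ (atil ^ 2 - P * b ^ 2)) :
    {v : ℂ × ℂ × ℂ | v.2.1 ^ 2 = P.eval v.1 ∧ 2 * v.2.2 ^ 2 + r₂.eval v.1 = 0 ∧
        a.eval v.1 + v.2.1 * b.eval v.1 = (r₂.eval v.1) ^ 2 / 4}.Finite ∧
    {v : ℂ × ℂ × ℂ | v.2.1 ^ 2 = P.eval v.1 ∧ 2 * v.2.2 ^ 2 + r₂.eval v.1 = 0 ∧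
        a.eval v.1 + v.2.1 * b.eval v.1 = (r₂.eval v.1) ^ 2 / 4}.ncard = 16 := by
  classical
  set D := atil ^ 2 - P * b ^ 2 with hD
  have hcard : D.roots.toFinset.card = 8 := by
    rw [hsf.card_toFinset_roots, hD, Polynomial.natDegree_sq_sub_mul_sq] <;> omega
  have hmem (x : ℂ) : x ∈ D.roots.toFinset ↔ atil.eval x ^ 2 = P.eval x * b.eval x ^ 2 := by
    rw [Multiset.mem_toFinset, Polynomial.mem_roots hsf.ne_zero, Polynomial.IsRoot.def, hD]
    simp [sub_eq_zero]
  have hb {x : ℂ} (hx : x ∈ D.roots.toFinset) : b.eval x ≠ 0 := by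
    intro h0
    refine hcop.eval_ne_zero h0 ?_
    simpa [h0] using (hmem x).1 hx
  have hr₂ {x : ℂ} (hx : x ∈ D.roots.toFinset) : r₂.eval x ≠ 0 :=
    hr.eval_ne_zero (Polynomial.isRoot_of_mem_roots (Multiset.mem_toFinset.1 hx))
  have ha (x : ℂ) : atil.eval x = a.eval x - r₂.eval x ^ 2 / 4 := by
    rw [hatil]
    simp
    ring
  choose s hs using fun x : ℂ => IsAlgClosed.exists_pow_nat_eq (-r₂.eval x / 2) two_pos
  let f : ℂ × ℂ → ℂ × ℂ × ℂ := fun q => (q.1, -atil.eval q.1 / b.eval q.1, q.2 * s q.1)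
  let T : Finset (ℂ × ℂ) := D.roots.toFinset ×ˢ {1, -1}
  have hinj : Set.InjOn f T := by
    rintro ⟨x, ε⟩ hx ⟨x', ε'⟩ - h
    have hxD : x ∈ D.roots.toFinset := (Finset.mem_product.1 hx).1
    simp only [f, Prod.mk.injEq] at h
    obtain ⟨rfl, -, h⟩ := h
    have hsx : s x ≠ 0 := by
      intro h0
      have := hs x
      rw [h0] at this
      exact hr₂ hxD (by linear_combination 2 * this)
    rw [mul_right_cancel₀ hsx h]
  have hset : {v : ℂ × ℂ × ℂ | v.2.1 ^ 2 = P.eval v.1 ∧ 2 * v.2.2 ^ 2 + r₂.eval v.1 = 0 ∧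
      a.eval v.1 + v.2.1 * b.eval v.1 = (r₂.eval v.1) ^ 2 / 4} = ↑(T.image f) := by
    ext ⟨x, y, l⟩
    simp only [Set.mem_ofPred_eq, Finset.coe_image, Set.mem_image, Finset.mem_coe, Prod.exists, T, f,
      Finset.mem_product, Finset.mem_insert, Finset.mem_singleton, Prod.mk.injEq]
    constructor
    · rintro ⟨hy, hl, hxy⟩
      have hay : atil.eval x = -(y * b.eval x) := by
        rw [ha]
        linear_combination hxy
      have hx : x ∈ D.roots.toFinset := by
        rw [hmem, hay, ← hy]
        ring
      have hy' : -atil.eval x / b.eval x = y := by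
        rw [hay, neg_neg, mul_div_cancel_right₀ _ (hb hx)]
      have hls : l ^ 2 = s x ^ 2 := by
        rw [hs]
        linear_combination hl / 2
      rcases sq_eq_sq_iff_eq_or_eq_neg.1 hls with h | h
      · exact ⟨x, 1, ⟨hx, .inl rfl⟩, rfl, hy', by rw [h, one_mul]⟩
      · exact ⟨x, -1, ⟨hx, .inr rfl⟩, rfl, hy', by rw [h, neg_one_mul]⟩
    · rintro ⟨x, ε, ⟨hx, hε⟩, rfl, rfl, rfl⟩
      have hbx := hb hx
      have hε2 : ε ^ 2 = 1 := sq_eq_one_iff.2 hε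
      refine ⟨?_, ?_, ?_⟩
      · rw [div_pow, neg_sq, (hmem x).1 hx, mul_div_cancel_right₀ _ (pow_ne_zero 2 hbx)]
      · rw [mul_pow, hε2, hs]
        ring
      · rw [div_mul_cancel₀ _ hbx, ha]
        ring
  rw [hset, Set.ncard_coe_finset, Finset.card_image_of_injOn hinj, Finset.card_product, hcard,
    Finset.card_pair (by norm_num)]
  exact ⟨Finset.finite_toSet _, rfl⟩
end
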